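/- For every d ∈ ℕ and every nonempty finite lower set Δ ⊆ ℕ₀^d, one has Σ_{i∈Δ} (4/π)^{|i|₀} ≤ |Δ|^{log(1+4/π)/log 2}. -/

import Mathlib

open scoped BigOperators

/-- `|i|₀`: the number of nonzero entries of a multi-index `i ∈ ℕ₀^d`. -/
def zeroNorm {d : ℕ} (i : Fin d → ℕ) : ℕ := (Finset.univ.filter fun j => i j ≠ 0).card

/-- A finite set `Δ ⊆ ℕ₀^d` is lower (downwards closed) if whenever `i ∈ Δ` and
`i'_j ≤ i_j` for all `j`, then `i' ∈ Δ`. -/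
def IsLowerIndexSet {d : ℕ} (Δ : Finset (Fin d → ℕ)) : Prop :=
  ∀ i ∈ Δ, ∀ i' : Fin d → ℕ, (∀ j, i' j ≤ i j) → i' ∈ Δ

theorem rpow_add_two_rpow_sub_one_mul_rpow_le {β m n : ℝ} (hβ : 1 ≤ β) (hn : 0 < n) (hnm : n ≤ m) :
    m ^ β + (2 ^ β - 1) * n ^ β ≤ (m + n) ^ β := by
  have hm : 0 < m := hn.trans_le hnm
  have hc := convexOn_rpow hβ
  have hs : n / m ≤ 1 := (div_le_one hm).2 hnm
  have hs0 : 0 ≤ n / m := by positivity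
  have hn' : n ∈ Set.Ici (0 : ℝ) := hn.le
  have hmn' : m + n ∈ Set.Ici (0 : ℝ) := (add_pos hm hn).le
  have h1 := hc.2 hn' hmn' (sub_nonneg.2 hs) hs0 (by ring)
  have h2 := hc.2 hn' hmn' hs0 (sub_nonneg.2 hs) (by ring)
  have e1 : (1 - n / m) • n + (n / m) • (m + n) = 2 * n := by
    simp only [smul_eq_mul]; field_simp; ring
  have e2 : (n / m) • n + (1 - n / m) • (m + n) = m := by
    simp only [smul_eq_mul]; field_simp; ring
  beta_reduce at h1 h2
  rw [e1, Real.mul_rpow two_pos.le hn.le] at h1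
  rw [e2] at h2
  simp only [smul_eq_mul] at h1 h2
  linarith

theorem zeroNorm_eq_update_add_one {d : ℕ} {i : Fin d → ℕ} {j : Fin d} (hj : i j ≠ 0) :
    zeroNorm i = zeroNorm (Function.update i j 0) + 1 := by
  have hset : (Finset.univ.filter fun l => i l ≠ 0) =
      insert j (Finset.univ.filter fun l => Function.update i j 0 l ≠ 0) := by
    ext l
    by_cases h : l = j
    · subst h; simp [hj]
    · simp [h]
  rw [zeroNorm, hset, Finset.card_insert_of_notMem (by simp), zeroNorm]

theorem IsLowerIndexSet.filter_ne_of_le {d : ℕ} {Δ : Finset (Fin d → ℕ)}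
    (hlow : IsLowerIndexSet Δ) {j : Fin d} {k : ℕ} (hk : ∀ i ∈ Δ, i j ≤ k) :
    IsLowerIndexSet (Δ.filter fun i => ¬ i j = k) := by
  intro i hi i' hle
  rw [Finset.mem_filter] at hi ⊢
  have := hk i hi.1
  have := hle j
  exact ⟨hlow i hi.1 i' hle, by have := hi.2; omega⟩

theorem IsLowerIndexSet.image_update_filter_eq {d : ℕ} {Δ : Finset (Fin d → ℕ)}
    (hlow : IsLowerIndexSet Δ) (j : Fin d) (k : ℕ) :
    IsLowerIndexSet ((Δ.filter fun i => i j = k).image fun i => Function.update i j 0) := by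
  intro x hx i' hle
  obtain ⟨i, hi, rfl⟩ := Finset.mem_image.1 hx
  rw [Finset.mem_filter] at hi
  have hj : i' j = 0 := by simpa using hle j
  refine Finset.mem_image.2 ⟨Function.update i' j k, Finset.mem_filter.2 ⟨?_, by simp⟩, ?_⟩
  · refine hlow i hi.1 _ fun l => ?_
    by_cases h : l = j
    · subst h; simp [hi.2]
    · simpa [h] using hle l
  · simp [← hj]

theorem injOn_update_zero {d : ℕ} (Δ : Finset (Fin d → ℕ)) (j : Fin d) (k : ℕ) :
    Set.InjOn (fun i : Fin d → ℕ => Function.update i j 0) (Δ.filter fun i => i j = k) := by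
  intro x hx y hy hxy
  simp only [Finset.coe_filter, Set.mem_ofPred_eq] at hx hy
  ext l
  by_cases h : l = j
  · subst h; rw [hx.2, hy.2]
  · simpa [h] using congrFun hxy l

/-- If `β ≥ 1`, the sum of `(2 ^ β - 1) ^ |i|₀` over a nonempty finite lower set `Δ` is at most
`|Δ| ^ β`. -/
theorem IsLowerIndexSet.sum_pow_zeroNorm_le {d : ℕ} {β : ℝ} (hβ : 1 ≤ β)
    (Δ : Finset (Fin d → ℕ)) (hne : Δ.Nonempty) (hlow : IsLowerIndexSet Δ) :
    ∑ i ∈ Δ, ((2 : ℝ) ^ β - 1) ^ zeroNorm i ≤ (Δ.card : ℝ) ^ β := by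
  induction hN : Δ.card using Nat.strong_induction_on generalizing Δ with
  | _ N ih =>
  subst hN
  by_cases hzero : ∀ i ∈ Δ, i = 0
  · obtain rfl : Δ = {0} := Finset.eq_singleton_iff_nonempty_unique_mem.2 ⟨hne, hzero⟩
    simp [zeroNorm]
  · push Not at hzero
    obtain ⟨i₀, hi₀, h₀⟩ := hzero
    obtain ⟨j, hj⟩ := Function.ne_iff.1 h₀
    obtain ⟨t, ht, hmax⟩ := Δ.exists_max_image (fun i => i j) hne
    have hk : t j ≠ 0 := by have := hmax i₀ hi₀; simp at hj; omega
    set T := Δ.filter fun i => i j = t j with hT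
    set R := Δ.filter fun i => ¬ i j = t j with hR
    set T' := T.image fun i => Function.update i j 0 with hT'
    have hinj := injOn_update_zero Δ j (t j)
    have hcardT' : T'.card = T.card := Finset.card_image_of_injOn hinj
    have hcard : T.card + R.card = Δ.card := Finset.card_filter_add_card_filter_not _
    have hTne : T.Nonempty := ⟨t, Finset.mem_filter.2 ⟨ht, rfl⟩⟩
    have hsub : T' ⊆ R := by
      intro x hx
      obtain ⟨i, hi, rfl⟩ := Finset.mem_image.1 hx
      rw [hT, Finset.mem_filter] at hi
      refine Finset.mem_filter.2 ⟨hlow i hi.1 _ fun l => ?_, by simpa using hk.symm⟩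
      by_cases h : l = j
      · subst h; simp
      · simp [h]
    have hle : T.card ≤ R.card := hcardT' ▸ Finset.card_le_card hsub
    have hTpos := hTne.card_pos
    have hsumR := ih R.card (by omega) R (Finset.card_pos.1 (by omega))
      (hlow.filter_ne_of_le hmax) rfl
    have hsumT' := ih T'.card (by omega) T' (hTne.image _)
      (hlow.image_update_filter_eq j (t j)) rfl
    have hsumT : ∑ i ∈ T, ((2 : ℝ) ^ β - 1) ^ zeroNorm i =
        (2 ^ β - 1) * ∑ i ∈ T', ((2 : ℝ) ^ β - 1) ^ zeroNorm i := by
      rw [hT', Finset.sum_image hinj, Finset.mul_sum]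
      refine Finset.sum_congr rfl fun i hi => ?_
      rw [Finset.mem_filter] at hi
      rw [zeroNorm_eq_update_add_one (hi.2 ▸ hk), pow_succ']
    have hb : (0 : ℝ) ≤ 2 ^ β - 1 :=
      sub_nonneg.2 (Real.one_le_rpow one_le_two (zero_le_one.trans hβ))
    rw [← Finset.sum_filter_add_sum_filter_not Δ (fun i => i j = t j), ← hT, ← hR, hsumT]
    have hconv := rpow_add_two_rpow_sub_one_mul_rpow_le hβ (Nat.cast_pos.2 hTpos) (Nat.cast_le.2 hle)
    rw [hcardT'] at hsumT'
    rw [← Nat.cast_add, add_comm R.card, hcard] at hconv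
    linarith [mul_le_mul_of_nonneg_left hsumT' hb]

/-- For every nonempty finite lower set `Δ ⊆ ℕ₀^d`,
`Σ_{i∈Δ} (4/π)^{|i|₀} ≤ |Δ|^{log(1+4/π)/log 2}`. -/
theorem stmt11 (d : ℕ) (Δ : Finset (Fin d → ℕ)) (hne : Δ.Nonempty)
    (hlow : IsLowerIndexSet Δ) :
    ∑ i ∈ Δ, (4 / Real.pi) ^ zeroNorm i ≤
      (Δ.card : ℝ) ^ (Real.log (1 + 4 / Real.pi) / Real.log 2) := by
  have ha : 1 ≤ 4 / Real.pi := (one_le_div Real.pi_pos).2 Real.pi_le_four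
  have hβ : 1 ≤ Real.log (1 + 4 / Real.pi) / Real.log 2 :=
    (one_le_div (Real.log_pos one_lt_two)).2 (Real.log_le_log two_pos (by linarith))
  have hpow : (2 : ℝ) ^ (Real.log (1 + 4 / Real.pi) / Real.log 2) - 1 = 4 / Real.pi := by
    rw [Real.log_div_log, Real.rpow_logb two_pos (by norm_num) (by linarith)]
    ring
  simpa only [hpow] using IsLowerIndexSet.sum_pow_zeroNorm_le hβ Δ hne hlow
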